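/- Let A be the companion matrix of f(x) = (x-1)³(x²+1) and B the companion matrix of g(x) = (x+1)(x⁴+1), and set T = B·A⁻¹ in GL(5,ℚ). Then T² = I with T ≠ I, B has order 8 and no power of B equals −I, and the hypergeometric group Γ(f,g) = ⟨A,B⟩ is the free product of the subgroup generated by T and the subgroup generated by B: the canonical group homomorphism from the abstract free product (ℤ/2ℤ) ∗ (ℤ/8ℤ) to GL(5,ℚ) sending the generator of ℤ/2ℤ to T and the generator of ℤ/8ℤ to B is injective with image Γ(f,g). -/

import Mathlib

open Polynomial Matrix

/-- The companion matrix of a monic degree-5 rational polynomial `p`: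
the `5 × 5` matrix whose entries in position `(i+1, i)` equal `1` for
`i = 1, ..., 4`, whose last column is `(-p₀, -p₁, -p₂, -p₃, -p₄)ᵀ`
(where `pᵢ` is the coefficient of `xⁱ` in `p`), and whose remaining
entries are `0`. -/
def companionMatrix (p : ℚ[X]) : Matrix (Fin 5) (Fin 5) ℚ :=
  Matrix.of fun i j : Fin 5 =>
    if (j : ℕ) = 4 then -p.coeff i
    else if (i : ℕ) = (j : ℕ) + 1 then 1 else 0

namespace Monoid.Coprod

/-- The ping-pong lemma for the free product of two groups. -/
theorem lift_injective_of_ping_pong {G H K : Type} [Group G] [instH : Group H]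
    [instK : Group K]
    {α : Type*} [MulAction G α] (f : H →* G) (g : K →* G) (hcard : 3 ≤ Cardinal.mk K)
    {X Y : Set α} (hX : X.Nonempty) (hY : Y.Nonempty) (hXY : Disjoint X Y)
    (hf : ∀ h, h ≠ 1 → ∀ y ∈ Y, f h • y ∈ X) (hg : ∀ k, k ≠ 1 → ∀ x ∈ X, g k • x ∈ Y) :
    Function.Injective (lift f g) := by
  let F : Bool → Type := fun b => cond b H K
  let instF : ∀ b, Group (F b) := fun b => match b with
    | true => instH
    | false => instK
  let p : ∀ b, F b →* G := fun b => match b with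
    | true => f
    | false => g
  have hp : Function.Injective (CoprodI.lift p) := by
    refine CoprodI.lift_injective_of_ping_pong p (.inr ⟨false, hcard⟩)
      (fun b => cond b X Y) ?_ ?_ ?_
    · rintro (_ | _)
      exacts [hY, hX]
    · rintro (_ | _) (_ | _) hij
      exacts [absurd rfl hij, hXY.symm, hXY, absurd rfl hij]
    · rintro (_ | _) (_ | _) hij h hh
      · exact absurd rfl hij
      · rintro _ ⟨x, hx, rfl⟩
        exact hg h hh x hx
      · rintro _ ⟨y, hy, rfl⟩
        exact hf h hh y hy
      · exact absurd rfl hij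
  let toCoprodI : H ∗ K →* CoprodI F :=
    lift (CoprodI.of (M := F) (i := true)) (CoprodI.of (M := F) (i := false))
  let incl : ∀ b, F b →* H ∗ K := fun b => match b with
    | true => inl
    | false => inr
  let ofCoprodI : CoprodI F →* H ∗ K := CoprodI.lift incl
  have hinv : ofCoprodI.comp toCoprodI = .id _ := by
    apply hom_ext
    · ext h
      exact CoprodI.lift_of (M := F) (i := true) incl h
    · ext k
      exact CoprodI.lift_of (M := F) (i := false) incl k
  have hinj : Function.Injective toCoprodI :=
    Function.LeftInverse.injective (g := ofCoprodI) fun w => DFunLike.congr_fun hinv w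
  have hcomp : lift f g = (CoprodI.lift p).comp toCoprodI := by
    apply hom_ext
    · ext h
      exact (CoprodI.lift_of (M := F) (i := true) p h).symm
    · ext k
      exact (CoprodI.lift_of (M := F) (i := false) p k).symm
  rw [hcomp]
  exact hp.comp hinj

end Monoid.Coprod

/-- The homomorphism from the cyclic group of order `n` sending the generator to `g`. -/
def zmodPowersHom {G : Type*} [Group G] (n : ℕ) (g : G) (hg : g ^ n = 1) :
    Multiplicative (ZMod n) →* G :=
  AddMonoidHom.toMultiplicativeLeft
    (ZMod.lift n ⟨zmultiplesHom (Additive G) (Additive.ofMul g), by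
      simpa [← ofMul_pow] using hg⟩)

theorem zmodPowersHom_natCast {G : Type*} [Group G] (n : ℕ) (g : G) (hg : g ^ n = 1) (k : ℕ) :
    zmodPowersHom n g hg (Multiplicative.ofAdd (k : ZMod n)) = g ^ k := by
  have := ZMod.lift_coe n ⟨zmultiplesHom (Additive G) (Additive.ofMul g), by
      simpa [← ofMul_pow] using hg⟩ (k : ℤ)
  simp only [Int.cast_natCast] at this
  simp [zmodPowersHom, this]

theorem zmodPowersHom_eq_pow_val {G : Type*} [Group G] (n : ℕ) [NeZero n] (g : G)
    (hg : g ^ n = 1) (k : Multiplicative (ZMod n)) :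
    zmodPowersHom n g hg k = g ^ k.toAdd.val := by
  rw [← zmodPowersHom_natCast n g hg, ZMod.natCast_zmod_val, ofAdd_toAdd]

/-- The natural action of `GL n R` on column vectors. -/
abbrev glMulVecAction (n R : Type*) [Fintype n] [DecidableEq n] [CommRing R] :
    MulAction (GL n R) (n → R) where
  smul g x := (g : Matrix n n R) *ᵥ x
  one_smul x := Matrix.one_mulVec x
  mul_smul g h x := (Matrix.mulVec_mulVec x (g : Matrix n n R) h).symm

namespace HypergeometricCase

/-- The action of the companion matrix of `(X + 1) * (X ^ 4 + 1)` on column vectors. -/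
def rotate (x : Fin 5 → ℚ) : Fin 5 → ℚ := ![-x 4, x 0 - x 4, x 1, x 2, x 3 - x 4]

/-- The action of the reflection `T` on column vectors. -/
def reflect (x : Fin 5 → ℚ) : Fin 5 → ℚ :=
  ![-x 0, 2 * x 0 + x 1, -4 * x 0 + x 2, 4 * x 0 + x 3, -4 * x 0 + x 4]

/-- The interior of a polyhedral cone that every `reflect ∘ rotate^[i]` with `0 < i < 8`
preserves up to sign. -/
def InCone (x : Fin 5 → ℚ) : Prop :=
  0 < -7 * x 0 - x 1 + x 2 - x 3 + x 4 ∧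
  0 < -x 0 + x 1 - x 2 + x 3 + 7 * x 4 ∧
  0 < -x 0 + x 1 + 7 * x 2 + 9 * x 3 + 7 * x 4 ∧
  0 < x 0 - x 1 + x 2 + 7 * x 3 + 9 * x 4 ∧
  0 < x 0 + x 1 + x 2 + x 3 + x 4 ∧
  0 < 3 * x 0 - x 1 - x 2 - x 3 - x 4 ∧
  0 < 3 * x 0 + x 1 - x 2 - 3 * x 3 - x 4 ∧
  0 < 3 * x 0 + x 1 + 3 * x 2 + x 3 - x 4 ∧
  0 < 7 * x 0 - 7 * x 1 - 9 * x 2 - 7 * x 3 - x 4 ∧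
  0 < 7 * x 0 - 7 * x 1 - x 2 + x 3 - x 4 ∧
  0 < 9 * x 0 - 9 * x 1 - 7 * x 2 - x 3 + x 4 ∧
  0 < 11 * x 0 + 5 * x 1 + 3 * x 2 - 3 * x 3 - 5 * x 4

theorem rotate_neg (x : Fin 5 → ℚ) : rotate (-x) = -rotate x := by
  ext i
  fin_cases i <;> simp [rotate] <;> ring

theorem iterate_rotate_neg (i : ℕ) (x : Fin 5 → ℚ) : rotate^[i] (-x) = -rotate^[i] x :=
  Function.Semiconj.iterate_right (f := Neg.neg) (fun x => (rotate_neg x).symm) i x |>.symm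

theorem reflect_neg (x : Fin 5 → ℚ) : reflect (-x) = -reflect x := by
  ext i
  fin_cases i <;> simp [reflect] <;> ring

theorem InCone.reflect_rotate {x : Fin 5 → ℚ} (hx : InCone x) {i : ℕ} (hi : 0 < i) (hi' : i < 8) :
    InCone (reflect (rotate^[i] x)) ∨ InCone (-reflect (rotate^[i] x)) := by
  obtain ⟨h1, h2, h3, h4, h5, h6, h7, h8, h9, h10, h11, h12⟩ := hx
  interval_cases i
  on_goal 2 => right
  on_goal 4 => right
  on_goal 6 => right
  on_goal 1 => left
  on_goal 3 => left
  on_goal 5 => left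
  on_goal 7 => left
  all_goals
    simp only [InCone, reflect, rotate, Function.iterate_succ, Function.iterate_zero,
      Function.comp_apply, id_eq, Pi.neg_apply, Matrix.cons_val]
    refine ⟨?_, ?_, ?_, ?_, ?_, ?_, ?_, ?_, ?_, ?_, ?_, ?_⟩ <;> linarith

theorem InCone.not_rotate {x : Fin 5 → ℚ} (hx : InCone x) {i : ℕ} (hi : 0 < i) (hi' : i < 8) :
    ¬InCone (rotate^[i] x) ∧ ¬InCone (-rotate^[i] x) := by
  obtain ⟨h1, h2, h3, h4, h5, h6, h7, h8, h9, h10, h11, h12⟩ := hx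
  interval_cases i <;> constructor <;>
    simp only [InCone, rotate, Function.iterate_succ, Function.iterate_zero,
      Function.comp_apply, id_eq, Pi.neg_apply, Matrix.cons_val] <;>
    rintro ⟨k1, k2, k3, k4, k5, k6, k7, k8, k9, k10, k11, k12⟩ <;> linarith

theorem exists_inCone : ∃ x, InCone x :=
  ⟨![5, -7, 12, -12, 12], by simp only [InCone, Matrix.cons_val]; norm_num⟩

/-- The matrix of `rotate`. -/
def rotateMatrix : Matrix (Fin 5) (Fin 5) ℚ :=
  !![0, 0, 0, 0, -1; 1, 0, 0, 0, -1; 0, 1, 0, 0, 0; 0, 0, 1, 0, 0; 0, 0, 0, 1, -1]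

/-- The matrix of `reflect`. -/
def reflectMatrix : Matrix (Fin 5) (Fin 5) ℚ :=
  !![-1, 0, 0, 0, 0; 2, 1, 0, 0, 0; -4, 0, 1, 0, 0; 4, 0, 0, 1, 0; -4, 0, 0, 0, 1]

theorem rotateMatrix_mulVec (x : Fin 5 → ℚ) : rotateMatrix *ᵥ x = rotate x := by
  ext i
  fin_cases i <;> simp [rotateMatrix, rotate, Matrix.mulVec, dotProduct, Fin.sum_univ_five] <;> ring

theorem rotateMatrix_pow_mulVec (i : ℕ) (x : Fin 5 → ℚ) :
    rotateMatrix ^ i *ᵥ x = rotate^[i] x := by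
  induction i with
  | zero => simp
  | succ n ih =>
    rw [pow_succ', ← Matrix.mulVec_mulVec, ih, rotateMatrix_mulVec, Function.iterate_succ_apply']

theorem reflectMatrix_mulVec (x : Fin 5 → ℚ) : reflectMatrix *ᵥ x = reflect x := by
  ext i
  fin_cases i <;> simp [reflectMatrix, reflect, Matrix.mulVec, dotProduct, Fin.sum_univ_five]

theorem rotateMatrix_pow_four : rotateMatrix ^ 4 =
    !![0, -1, 1, -1, 1; 0, -1, 0, 0, 0; 0, 0, -1, 0, 0; 0, 0, 0, -1, 0; 1, -1, 1, -1, 0] := by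
  decide +kernel

theorem rotateMatrix_pow_eight : rotateMatrix ^ 8 = 1 := by
  decide +kernel

theorem rotateMatrix_pow_ne_neg_one {i : ℕ} (hi : i < 8) : rotateMatrix ^ i ≠ -1 := by
  interval_cases i <;> decide +kernel

theorem reflectMatrix_sq : reflectMatrix ^ 2 = 1 := by
  decide +kernel

theorem companionMatrix_g : companionMatrix ((X + 1) * (X ^ 4 + 1)) = rotateMatrix := by
  have h : ((X + 1) * (X ^ 4 + 1) : ℚ[X]) = X ^ 5 + X ^ 4 + X + 1 := by ring
  ext i j
  fin_cases i <;> fin_cases j <;>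
    simp [h, companionMatrix, rotateMatrix, coeff_X, coeff_one, coeff_X_pow]

theorem reflectMatrix_mul_companionMatrix_f :
    reflectMatrix * companionMatrix ((X - 1) ^ 3 * (X ^ 2 + 1)) = rotateMatrix := by
  have h : ((X - 1) ^ 3 * (X ^ 2 + 1) : ℚ[X]) =
      X ^ 5 - C 3 * X ^ 4 + C 4 * X ^ 3 - C 4 * X ^ 2 + C 3 * X - C 1 := by
    simp only [map_ofNat, map_one]
    ring
  have hA : companionMatrix ((X - 1) ^ 3 * (X ^ 2 + 1)) =
      !![0, 0, 0, 0, 1; 1, 0, 0, 0, -3; 0, 1, 0, 0, 4; 0, 0, 1, 0, -4; 0, 0, 0, 1, 3] := by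
    ext i j
    fin_cases i <;> fin_cases j <;>
      simp [h, companionMatrix, coeff_X, coeff_C, coeff_X_pow, -map_one]
  rw [hA]
  decide +kernel

end HypergeometricCase

open HypergeometricCase

/-- `Γ(f,g) = ⟨T⟩ ∗ ⟨B⟩` for `f = ((X - 1) ^ 3 * (X ^ 2 + 1))`, `g = ((X + 1) * (X ^ 4 + 1))`. -/
theorem hypergeometric_free_product_case17 (A B T : GL (Fin 5) ℚ)
    (hA : (↑A : Matrix (Fin 5) (Fin 5) ℚ) = companionMatrix ((X - 1) ^ 3 * (X ^ 2 + 1)))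
    (hB : (↑B : Matrix (Fin 5) (Fin 5) ℚ) = companionMatrix ((X + 1) * (X ^ 4 + 1)))
    (hT : T = B * A⁻¹) :
    T ^ 2 = 1 ∧ T ≠ 1 ∧ orderOf B = 8 ∧ (∀ i : ℤ, B ^ i ≠ -1) ∧
    ∃ φ : Monoid.Coprod (Multiplicative (ZMod 2)) (Multiplicative (ZMod 8)) →* GL (Fin 5) ℚ,
      φ (Monoid.Coprod.inl (Multiplicative.ofAdd (1 : ZMod 2))) = T ∧
      φ (Monoid.Coprod.inr (Multiplicative.ofAdd (1 : ZMod 8))) = B ∧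
      Function.Injective φ ∧
      φ.range = Subgroup.closure {A, B} := by
  have hBm : (B : Matrix (Fin 5) (Fin 5) ℚ) = rotateMatrix := hB.trans companionMatrix_g
  have hTA : T * A = B := by rw [hT, inv_mul_cancel_right]
  have hTm : (T : Matrix (Fin 5) (Fin 5) ℚ) = reflectMatrix := by
    have : (B : Matrix (Fin 5) (Fin 5) ℚ) = reflectMatrix * A := by
      rw [hBm, hA, reflectMatrix_mul_companionMatrix_f]
    rw [hT, Units.val_mul, this, Matrix.mul_assoc, Units.mul_inv, Matrix.mul_one]
  have hT2 : T ^ 2 = 1 := Units.ext (by simp [hTm, reflectMatrix_sq])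
  have hB8 : B ^ 8 = 1 := Units.ext (by simp [hBm, rotateMatrix_pow_eight])
  have hordB : orderOf B = 2 ^ (2 + 1) := by
    refine orderOf_eq_prime_pow (fun h => ?_) hB8
    have h' := congrArg (fun g : GL (Fin 5) ℚ => (g : Matrix (Fin 5) (Fin 5) ℚ) 0 0) h
    simp [hBm, rotateMatrix_pow_four] at h'
  refine ⟨hT2, fun h => ?_, hordB, fun i hi => ?_, ?_⟩
  · have h' := congrArg (fun g : GL (Fin 5) ℚ => (g : Matrix (Fin 5) (Fin 5) ℚ) 1 0) h
    simp [hTm, reflectMatrix] at h'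
  · obtain ⟨n, hn⟩ := Int.eq_ofNat_of_zero_le (Int.emod_nonneg i (by norm_num : (8 : ℤ) ≠ 0))
    have hn8 : n < 8 := by omega
    have hin : B ^ i = B ^ n := by
      rw [← zpow_mod_orderOf, hordB]
      norm_num [hn]
    apply rotateMatrix_pow_ne_neg_one hn8
    rw [← hBm, ← Units.val_pow_eq_pow_val, ← hin, hi]
    rfl
  let := glMulVecAction (Fin 5) ℚ
  have hBsmul (i : ℕ) (x : Fin 5 → ℚ) : B ^ i • x = rotate^[i] x := by
    rw [← rotateMatrix_pow_mulVec, ← hBm, ← Units.val_pow_eq_pow_val]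
    rfl
  have hTsmul (x : Fin 5 → ℚ) : T • x = reflect x := by
    rw [← reflectMatrix_mulVec, ← hTm]
    rfl
  refine ⟨Monoid.Coprod.lift (zmodPowersHom 2 T hT2) (zmodPowersHom 8 B hB8), ?_, ?_, ?_, ?_⟩
  · simpa using zmodPowersHom_natCast 2 T hT2 1
  · simpa using zmodPowersHom_natCast 8 B hB8 1
  · obtain ⟨x₀, hx₀⟩ := exists_inCone
    refine Monoid.Coprod.lift_injective_of_ping_pong _ _ ?_
      (X := {x | InCone x ∨ InCone (-x)})
      (Y := {y | ∃ i, 0 < i ∧ i < 8 ∧ ∃ x, InCone x ∧ (y = rotate^[i] x ∨ y = -rotate^[i] x)})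
      ⟨x₀, .inl hx₀⟩ ⟨rotate^[1] x₀, 1, by norm_num, by norm_num, x₀, hx₀, .inl rfl⟩ ?_ ?_ ?_
    · rw [Cardinal.mk_fintype, Fintype.card_multiplicative, ZMod.card]
      norm_num
    · rw [Set.disjoint_left]
      rintro _ hy ⟨i, hi, hi', x, hx, rfl | rfl⟩
      · exact hy.elim (hx.not_rotate hi hi').1 (hx.not_rotate hi hi').2
      · rw [Set.mem_ofPred_eq, neg_neg] at hy
        exact hy.elim (hx.not_rotate hi hi').2 (hx.not_rotate hi hi').1
    · rintro h hh _ ⟨i, hi, hi', x, hx, hy⟩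
      have hh1 : h.toAdd.val = 1 := by
        have := ZMod.val_lt h.toAdd
        have : h.toAdd.val ≠ 0 := by simpa using hh
        omega
      rw [zmodPowersHom_eq_pow_val, hh1, pow_one, hTsmul]
      rcases hy with rfl | rfl
      · exact hx.reflect_rotate hi hi'
      · rw [Set.mem_ofPred_eq, reflect_neg, neg_neg]
        exact (hx.reflect_rotate hi hi').symm
    · rintro k hk x hx
      refine ⟨k.toAdd.val, Nat.pos_of_ne_zero (by simpa using hk), ZMod.val_lt _, ?_⟩
      rw [zmodPowersHom_eq_pow_val, hBsmul]
      rcases hx with hx | hx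
      · exact ⟨x, hx, .inl rfl⟩
      · exact ⟨-x, hx, .inr (by rw [iterate_rotate_neg, neg_neg])⟩
  · have hAB : A = T⁻¹ * B := by rw [← hTA, inv_mul_cancel_left]
    rw [Monoid.Coprod.range_lift]
    apply le_antisymm
    · have hBmem : B ∈ Subgroup.closure {A, B} := Subgroup.subset_closure (by simp)
      have hTmem : T ∈ Subgroup.closure {A, B} := by
        rw [hT]
        exact mul_mem hBmem (inv_mem (Subgroup.subset_closure (by simp)))
      refine sup_le ?_ ?_
      · rintro _ ⟨k, rfl⟩
        rw [zmodPowersHom_eq_pow_val]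
        exact pow_mem hTmem _
      · rintro _ ⟨k, rfl⟩
        rw [zmodPowersHom_eq_pow_val]
        exact pow_mem hBmem _
    · have hTmem : T ∈ (zmodPowersHom 2 T hT2).range :=
        ⟨_, by simpa using zmodPowersHom_natCast 2 T hT2 1⟩
      have hBmem : B ∈ (zmodPowersHom 8 B hB8).range :=
        ⟨_, by simpa using zmodPowersHom_natCast 8 B hB8 1⟩
      rw [Subgroup.closure_le]
      rintro _ (rfl | rfl)
      · rw [hAB]
        exact mul_mem (inv_mem (Subgroup.mem_sup_left hTmem)) (Subgroup.mem_sup_right hBmem)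
      · exact Subgroup.mem_sup_right hBmem
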